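/- arXiv:2404.12598 — 6 statements merged into one kernel-verified Lean document; each statement's English description precedes it below -/
import Mathlib

section
/- Suppose the sequences of nonnegative real numbers {e_i}_{i≥0}, {a_i}_{i≥0}, {η_i}_{i≥0} satisfy: a_i ∈ (0,1) for all i; e_{i+1} ≤ (1 − a_i) e_i + a_i² η_i for all i ≥ 0; a_i ≤ a_{i+1}(1 + A a_{i+1}) for all i ≥ 0, where A is a constant with 0 < A < 1; η_0 > 0 and η_i is nondecreasing in i; and 1/(1 − A) ≥ (1 − a_0) e_0 / (a_0 η_0) + a_0. Then e_{i+1} ≤ a_i η_i / (1 − A) for all i ≥ 0. -/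
/-- Lemma B.3, first part: the recursive mean-squared-error bound
`e_{i+1} ≤ a_i η_i / (1 − A)`. -/
theorem recursive_mse_bound
    (e a η : ℕ → ℝ) (A : ℝ)
    (he : ∀ i, 0 ≤ e i) (ha : ∀ i, a i ∈ Set.Ioo (0 : ℝ) 1) (hη : ∀ i, 0 ≤ η i)
    (hrec : ∀ i, e (i + 1) ≤ (1 - a i) * e i + (a i) ^ 2 * η i)
    (hA0 : 0 < A) (hA1 : A < 1)
    (hstep : ∀ i, a i ≤ a (i + 1) * (1 + A * a (i + 1)))
    (hη0 : 0 < η 0) (hηmono : Monotone η)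
    (hinit : (1 - a 0) * e 0 / (a 0 * η 0) + a 0 ≤ 1 / (1 - A)) :
    ∀ i, e (i + 1) ≤ a i * η i / (1 - A) := by
  have hA : 0 < 1 - A := sub_pos.mpr hA1
  intro i
  induction i with
  | zero =>
    have hpos : 0 < a 0 * η 0 := mul_pos (ha 0).1 hη0
    calc e (0 + 1) ≤ (1 - a 0) * e 0 + a 0 ^ 2 * η 0 := hrec 0
      _ = ((1 - a 0) * e 0 / (a 0 * η 0) + a 0) * (a 0 * η 0) := by
        rw [add_mul, div_mul_cancel₀ _ hpos.ne']
        ring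
      _ ≤ 1 / (1 - A) * (a 0 * η 0) := mul_le_mul_of_nonneg_right hinit hpos.le
      _ = a 0 * η 0 / (1 - A) := by ring
  | succ i ih =>
    obtain ⟨hb0, hb1⟩ := ha (i + 1)
    have hb : 0 ≤ 1 - a (i + 1) := sub_nonneg.mpr hb1.le
    have hprod : a i * η i ≤ a (i + 1) * (1 + A * a (i + 1)) * η (i + 1) :=
      mul_le_mul (hstep i) (hηmono i.le_succ) (hη i) (by positivity)
    have hslack : 0 ≤ A * a (i + 1) ^ 3 * η (i + 1) :=
      mul_nonneg (by positivity) (hη (i + 1))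
    rw [le_div_iff₀ hA] at ih ⊢
    calc e (i + 1 + 1) * (1 - A)
        ≤ ((1 - a (i + 1)) * e (i + 1) + a (i + 1) ^ 2 * η (i + 1)) * (1 - A) :=
          mul_le_mul_of_nonneg_right (hrec (i + 1)) hA.le
      _ = (1 - a (i + 1)) * (e (i + 1) * (1 - A)) + a (i + 1) ^ 2 * η (i + 1) * (1 - A) := by
          ring
      _ ≤ (1 - a (i + 1)) * (a (i + 1) * (1 + A * a (i + 1)) * η (i + 1))
            + a (i + 1) ^ 2 * η (i + 1) * (1 - A) :=
          add_le_add_left (mul_le_mul_of_nonneg_left (ih.trans hprod) hb) _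
      _ = a (i + 1) * η (i + 1) - A * a (i + 1) ^ 3 * η (i + 1) := by ring
      _ ≤ a (i + 1) * η (i + 1) := sub_le_self _ hslack
end

section
/- Let 0 < A < 1, p ∈ (1/2, 1], and α, β > 0 satisfy (β + 1)^p − β^p ≤ A α β^p / (β + 1)^p. Then the sequence a_i = α / (i + β)^p satisfies a_i ≤ a_{i+1}(1 + A a_{i+1}) for all integers i ≥ 0; in particular, for any p ∈ (1/2, 1] and any β > 0, this holds for all sufficiently large α. -/
/-- A concave function has decreasing increments. -/
lemma ConcaveOn.increment_le {s : Set ℝ} {f : ℝ → ℝ} (hf : ConcaveOn ℝ s f) {x y h : ℝ}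
    (hx : x ∈ s) (hy : y + h ∈ s) (hxy : x ≤ y) (hh : 0 < h) :
    f (y + h) - f y ≤ f (x + h) - f x := by
  have hd : 0 < y + h - x := by linarith
  have ha : 0 ≤ h / (y + h - x) := by positivity
  have hb : 0 ≤ (y - x) / (y + h - x) := div_nonneg (by linarith) hd.le
  have hab : h / (y + h - x) + (y - x) / (y + h - x) = 1 := by
    field_simp
    ring
  have left := hf.2 hx hy hb ha (by rw [add_comm]; exact hab)
  have right := hf.2 hx hy ha hb hab
  simp only [smul_eq_mul] at left right
  rw [show (y - x) / (y + h - x) * x + h / (y + h - x) * (y + h) = x + h by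
    field_simp
    ring] at left
  rw [show h / (y + h - x) * x + (y - x) / (y + h - x) * (y + h) = y by
    field_simp
    ring] at right
  linear_combination left + right - (f x + f (y + h)) * hab

/-- The ratio `x ^ p / (x + 1) ^ p` is nondecreasing in `x > 0` for `p ≥ 0`. -/
lemma Real.rpow_div_add_one_rpow_le {p x y : ℝ} (hp : 0 ≤ p) (hx : 0 < x) (hxy : x ≤ y) :
    x ^ p / (x + 1) ^ p ≤ y ^ p / (y + 1) ^ p := by
  have hy : 0 < y := hx.trans_le hxy
  rw [← Real.div_rpow hx.le (by positivity), ← Real.div_rpow hy.le (by positivity)]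
  refine Real.rpow_le_rpow (by positivity) ?_ hp
  rw [div_le_div_iff₀ (by positivity) (by positivity)]
  linarith

/-- Lemma B.3, second part: polynomially decaying step sizes
`a_i = α / (i + β)^p` satisfy the comparison condition `a_i ≤ a_{i+1}(1 + A a_{i+1})`
under the stated inequality on `(α, β)`, and for any `p ∈ (1/2, 1]` and `β > 0` that
inequality holds for all sufficiently large `α`. -/
theorem step_size_comparison
    (A p : ℝ) (hA0 : 0 < A) (hA1 : A < 1) (hp : 1 / 2 < p) (hp1 : p ≤ 1) :
    (∀ α β : ℝ, 0 < α → 0 < β →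
        (β + 1) ^ p - β ^ p ≤ A * α * β ^ p / (β + 1) ^ p →
        ∀ i : ℕ, α / ((i : ℝ) + β) ^ p
          ≤ (α / (((i : ℝ) + 1) + β) ^ p) * (1 + A * (α / (((i : ℝ) + 1) + β) ^ p))) ∧
    (∀ β : ℝ, 0 < β → ∃ α₀ : ℝ, ∀ α : ℝ, α₀ ≤ α →
        (β + 1) ^ p - β ^ p ≤ A * α * β ^ p / (β + 1) ^ p) := by
  have hp0 : 0 ≤ p := by linarith
  refine ⟨fun α β hα hβ h i => ?_, fun β hβ => ?_⟩
  · have hx : β ≤ (i : ℝ) + β := by simp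
    have hx0 : 0 < (i : ℝ) + β := hβ.trans_le hx
    rw [show (i : ℝ) + 1 + β = (i + β) + 1 by ring]
    generalize (i : ℝ) + β = x at hx hx0
    have increment : (x + 1) ^ p - x ^ p ≤ (β + 1) ^ p - β ^ p :=
      (Real.concaveOn_rpow hp0 hp1).increment_le (Set.mem_Ici.2 hβ.le)
        (Set.mem_Ici.2 (by positivity)) hx one_pos
    have key : (x + 1) ^ p - x ^ p ≤ A * α * x ^ p / (x + 1) ^ p := by
      refine increment.trans (h.trans ?_)
      rw [mul_div_assoc, mul_div_assoc]
      exact mul_le_mul_of_nonneg_left (Real.rpow_div_add_one_rpow_le hp0 hβ hx)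
        (by positivity)
    have hu : 0 < x ^ p := by positivity
    have hv : 0 < (x + 1) ^ p := by positivity
    generalize x ^ p = u at key hu
    generalize (x + 1) ^ p = v at key hv
    rw [le_div_iff₀ hv] at key
    rw [show α / v * (1 + A * (α / v)) = α * (v + A * α) / v ^ 2 by field_simp,
      div_le_div_iff₀ hu (by positivity)]
    linear_combination α * key
  · have hu : 0 < β ^ p := by positivity
    have hv : 0 < (β + 1) ^ p := by positivity
    refine ⟨((β + 1) ^ p - β ^ p) * (β + 1) ^ p / (A * β ^ p), fun α h => ?_⟩
    rw [div_le_iff₀ (by positivity)] at h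
    rw [le_div_iff₀ hv]
    linear_combination h
end

section
/- Let a be a real Gaussian random variable with law N(ψ₁, λψ₂). Then E[((a − ψ₁)/(2ψ₂)) · G(a)] = (λ/2)·((μ − r) − γσ²ψ₁); equivalently, when γσ² ≠ 0, this equals (λγσ²/2)·((μ − r)/(γσ²) − ψ₁). -/
open MeasureTheory ProbabilityTheory

lemma integrable_sub_pow_gaussianReal (m : ℝ) (v : NNReal) (n : ℕ) :
    Integrable (fun a : ℝ => (a - m) ^ n) (gaussianReal m v) := by
  have h : MemLp (fun a : ℝ => a - m) (n : NNReal) (gaussianReal m v) :=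
    (memLp_id_gaussianReal (n : NNReal)).sub (memLp_const m)
  exact (MemLp.integrable_norm_pow' h).mono (by fun_prop) (by simp)

lemma integral_sub_pow_gaussianReal_of_odd (m : ℝ) (v : NNReal) {n : ℕ} (hn : Odd n) :
    ∫ a, (a - m) ^ n ∂gaussianReal m v = 0 := by
  have hreflect : (gaussianReal m v).map (fun a => 2 * m - a) = gaussianReal m v := by
    rw [gaussianReal_map_const_sub]
    congr 1
    ring
  have h : ∫ a, (a - m) ^ n ∂gaussianReal m v = ∫ a, -(a - m) ^ n ∂gaussianReal m v := by
    conv_lhs => rw [← hreflect]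
    rw [integral_map (by fun_prop) (by fun_prop)]
    congr with a
    rw [← hn.neg_pow]
    ring
  rw [integral_neg] at h
  linarith

lemma integral_sub_sq_gaussianReal (m : ℝ) (v : NNReal) :
    ∫ a, (a - m) ^ 2 ∂gaussianReal m v = v := by
  rw [← variance_fun_id_gaussianReal (μ := m) (v := v), variance_eq_integral (by fun_prop),
    integral_id_gaussianReal]

/-- The mean of a cubic polynomial in the centred variable, without constant term. -/
lemma integral_centred_cubic_gaussianReal (m : ℝ) (v : NNReal) (c₁ c₂ c₃ : ℝ) :
    ∫ a, (c₁ * (a - m) ^ 1 + c₂ * (a - m) ^ 2 + c₃ * (a - m) ^ 3) ∂gaussianReal m v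
      = c₂ * v := by
  have hint (c : ℝ) (n : ℕ) : Integrable (fun a : ℝ => c * (a - m) ^ n) (gaussianReal m v) :=
    (integrable_sub_pow_gaussianReal m v n).const_mul c
  have hsum : Integrable (fun a : ℝ => c₁ * (a - m) ^ 1 + c₂ * (a - m) ^ 2) (gaussianReal m v) :=
    (hint _ _).add (hint _ _)
  rw [integral_add hsum (hint _ _), integral_add (hint _ _) (hint _ _),
    integral_const_mul, integral_const_mul, integral_const_mul,
    integral_sub_pow_gaussianReal_of_odd m v odd_one, integral_sub_sq_gaussianReal,
    integral_sub_pow_gaussianReal_of_odd m v (by decide : Odd 3)]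
  ring

/-- mean update direction `h_{ψ,1}` for the policy-mean parameter:
`E[((a − ψ₁)/(2ψ₂)) G(a)] = (λ/2)((μ − r) − γσ²ψ₁)`, which when `γσ² ≠ 0` equals
`(λγσ²/2)((μ−r)/(γσ²) − ψ₁)`. -/
theorem mean_update_psi1
    (μ r σ γ θ ψ₁ lam ψ₂ : ℝ) (hlam : 0 < lam) (hψ₂ : 0 < ψ₂) :
    (∫ a, ((a - ψ₁) / (2 * ψ₂))
          * (r + (μ - r) * a - (γ * σ ^ 2 / 2) * a ^ 2 - θ + (a - ψ₁) ^ 2 / (2 * ψ₂)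
            + (lam / 2) * Real.log (2 * Real.pi * lam) + (lam / 2) * Real.log ψ₂)
        ∂(gaussianReal ψ₁ (lam * ψ₂).toNNReal)
      = (lam / 2) * ((μ - r) - γ * σ ^ 2 * ψ₁)) ∧
    (γ * σ ^ 2 ≠ 0 →
      (lam / 2) * ((μ - r) - γ * σ ^ 2 * ψ₁)
        = (lam * γ * σ ^ 2 / 2) * ((μ - r) / (γ * σ ^ 2) - ψ₁)) := by
  refine ⟨?_, fun h => by
    have hγ : γ ≠ 0 := left_ne_zero_of_mul h
    have hσ : σ ≠ 0 := fun h0 => h (by simp [h0])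
    field_simp⟩
  have hv : ((lam * ψ₂).toNNReal : ℝ) = lam * ψ₂ := Real.coe_toNNReal _ (by positivity)
  have key := integral_centred_cubic_gaussianReal ψ₁ (lam * ψ₂).toNNReal
    ((r + (μ - r) * ψ₁ - γ * σ ^ 2 / 2 * ψ₁ ^ 2 - θ + lam / 2 * Real.log (2 * Real.pi * lam)
      + lam / 2 * Real.log ψ₂) / (2 * ψ₂))
    (((μ - r) - γ * σ ^ 2 * ψ₁) / (2 * ψ₂))
    ((1 / (2 * ψ₂) - γ * σ ^ 2 / 2) / (2 * ψ₂))
  rw [hv] at key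
  calc _ = _ := by
        congr with a
        ring
    _ = _ := key
    _ = _ := by field_simp
end

section
/- Let a be a real Gaussian random variable with law N(ψ₁, λψ₂). Then E[((a − ψ₁)²/2 − (λ/2)ψ₂) · G(a)] = (λ²/2)·(ψ₂ − γσ²ψ₂²); equivalently, this equals (λ²γσ²/2)·ψ₂·(1/(γσ²) − ψ₂) when γσ² ≠ 0. -/
open MeasureTheory ProbabilityTheory
open scoped NNReal

lemma integrable_pow_gaussianReal (m : ℝ) (v : ℝ≥0) (n : ℕ) :
    Integrable (fun x : ℝ ↦ x ^ n) (gaussianReal m v) :=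
  integrable_pow_of_mem_interior_integrableExpSet (X := fun x : ℝ ↦ x) (by simp) n

lemma integral_pow_gaussianReal_eq_iteratedDeriv (v : ℝ≥0) (n : ℕ) :
    ∫ x, x ^ n ∂(gaussianReal 0 v)
      = iteratedDeriv n (fun t : ℝ ↦ Real.exp (v * t ^ 2 / 2)) 0 := by
  have h := iteratedDeriv_mgf_zero (X := fun x : ℝ ↦ x) (μ := gaussianReal 0 v) (by simp) n
  simpa [mgf_fun_id_gaussianReal] using h.symm

lemma deriv_mul_exp_mul_sq {p p' : ℝ → ℝ} (hp : ∀ t, HasDerivAt p (p' t) t) (c : ℝ) :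
    deriv (fun t ↦ p t * Real.exp (c * t ^ 2 / 2))
      = fun t ↦ (p' t + c * t * p t) * Real.exp (c * t ^ 2 / 2) := by
  ext t
  have hq : HasDerivAt (fun t : ℝ ↦ c * t ^ 2 / 2) (c * t) t := by
    convert! (((hasDerivAt_id t).pow 2).const_mul c).div_const 2 using 1
    simp
    ring
  rw [((hp t).fun_mul hq.exp).deriv]
  ring

lemma iteratedDeriv_three_exp_mul_sq (c : ℝ) :
    iteratedDeriv 3 (fun t : ℝ ↦ Real.exp (c * t ^ 2 / 2))
      = fun t ↦ (3 * c ^ 2 * t + c ^ 3 * t ^ 3) * Real.exp (c * t ^ 2 / 2) := by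
  have h₁ : deriv (fun t : ℝ ↦ Real.exp (c * t ^ 2 / 2))
      = fun t ↦ (c * t) * Real.exp (c * t ^ 2 / 2) := by
    simpa using deriv_mul_exp_mul_sq (fun t ↦ hasDerivAt_const t (1 : ℝ)) c
  have h₂ (t : ℝ) : HasDerivAt (fun t : ℝ ↦ c * t) c t := by
    simpa using (hasDerivAt_id t).const_mul c
  have h₃ (t : ℝ) : HasDerivAt (fun t : ℝ ↦ c + c * t * (c * t)) (2 * c ^ 2 * t) t := by
    convert! ((h₂ t).mul (h₂ t)).const_add c using 1
    ring
  rw [iteratedDeriv_succ, iteratedDeriv_succ, iteratedDeriv_one, h₁,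
    deriv_mul_exp_mul_sq h₂, deriv_mul_exp_mul_sq h₃]
  ext t
  ring

lemma iteratedDeriv_four_exp_mul_sq_zero (c : ℝ) :
    iteratedDeriv 4 (fun t : ℝ ↦ Real.exp (c * t ^ 2 / 2)) 0 = 3 * c ^ 2 := by
  have h (t : ℝ) : HasDerivAt (fun t : ℝ ↦ 3 * c ^ 2 * t + c ^ 3 * t ^ 3)
      (3 * c ^ 2 + c ^ 3 * (3 * t ^ 2)) t := by
    simpa using ((hasDerivAt_id t).const_mul (3 * c ^ 2)).fun_add
      (((hasDerivAt_id t).pow 3).const_mul (c ^ 3))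
  rw [iteratedDeriv_succ, iteratedDeriv_three_exp_mul_sq, deriv_mul_exp_mul_sq h]
  simp

/-- The third moment of a centred Gaussian vanishes. -/
lemma integral_pow_three_gaussianReal (v : ℝ≥0) : ∫ x, x ^ 3 ∂(gaussianReal 0 v) = 0 := by
  rw [integral_pow_gaussianReal_eq_iteratedDeriv, iteratedDeriv_three_exp_mul_sq]
  simp

/-- The fourth moment of a centred Gaussian of variance `v` is `3 v²`. -/
lemma integral_pow_four_gaussianReal (v : ℝ≥0) :
    ∫ x, x ^ 4 ∂(gaussianReal 0 v) = 3 * (v : ℝ) ^ 2 := by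
  rw [integral_pow_gaussianReal_eq_iteratedDeriv, iteratedDeriv_four_exp_mul_sq_zero]

lemma integral_sq_gaussianReal (v : ℝ≥0) : ∫ x, x ^ 2 ∂(gaussianReal 0 v) = v := by
  have h := variance_fun_id_gaussianReal (μ := 0) (v := v)
  rw [variance_eq_integral (by fun_prop)] at h
  simpa using h

/-- For `x ~ N(0, v)`, `E[(x² - v)/2 · (A + B x + C x²)] = C v²`. -/
lemma integral_sq_sub_mul_quadratic_gaussianReal (v : ℝ≥0) (A B C : ℝ) :
    ∫ x, (x ^ 2 / 2 - v / 2) * (A + B * x + C * x ^ 2) ∂(gaussianReal 0 v)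
      = C * (v : ℝ) ^ 2 := by
  have hI := integrable_pow_gaussianReal 0 v
  have h₁ : ∫ x, x ^ 1 ∂(gaussianReal 0 v) = 0 := by simp
  have hexp (x : ℝ) : (x ^ 2 / 2 - v / 2) * (A + B * x + C * x ^ 2)
      = C / 2 * x ^ 4 + B / 2 * x ^ 3 + (A / 2 - C * v / 2) * x ^ 2
        + -(B * v / 2) * x ^ 1 + -(A * v / 2) := by ring
  simp_rw [hexp]
  rw [integral_add (((((hI 4).const_mul _).fun_add ((hI 3).const_mul _)).fun_add
      ((hI 2).const_mul _)).fun_add ((hI 1).const_mul _)) (integrable_const _),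
    integral_add ((((hI 4).const_mul _).fun_add ((hI 3).const_mul _)).fun_add
      ((hI 2).const_mul _)) ((hI 1).const_mul _),
    integral_add (((hI 4).const_mul _).fun_add ((hI 3).const_mul _)) ((hI 2).const_mul _),
    integral_add ((hI 4).const_mul _) ((hI 3).const_mul _)]
  simp only [integral_const_mul, integral_const, probReal_univ, smul_eq_mul, h₁,
    integral_sq_gaussianReal, integral_pow_three_gaussianReal, integral_pow_four_gaussianReal]
  ring

/-- mean update direction `h_{ψ,2}` for the policy-variance parameter:
`E[((a − ψ₁)²/2 − (λ/2)ψ₂) G(a)] = (λ²/2)(ψ₂ − γσ²ψ₂²)`, which when `γσ² ≠ 0` equals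
`(λ²γσ²/2) ψ₂ (1/(γσ²) − ψ₂)`. -/
theorem mean_update_psi2
    (μ r σ γ θ ψ₁ lam ψ₂ : ℝ) (hlam : 0 < lam) (hψ₂ : 0 < ψ₂) :
    (∫ a, ((a - ψ₁) ^ 2 / 2 - (lam / 2) * ψ₂)
          * (r + (μ - r) * a - (γ * σ ^ 2 / 2) * a ^ 2 - θ + (a - ψ₁) ^ 2 / (2 * ψ₂)
            + (lam / 2) * Real.log (2 * Real.pi * lam) + (lam / 2) * Real.log ψ₂)
        ∂(gaussianReal ψ₁ (lam * ψ₂).toNNReal)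
      = (lam ^ 2 / 2) * (ψ₂ - γ * σ ^ 2 * ψ₂ ^ 2)) ∧
    (γ * σ ^ 2 ≠ 0 →
      (lam ^ 2 / 2) * (ψ₂ - γ * σ ^ 2 * ψ₂ ^ 2)
        = (lam ^ 2 * γ * σ ^ 2 / 2) * ψ₂ * (1 / (γ * σ ^ 2) - ψ₂)) := by
  refine ⟨?_, fun h ↦ ?_⟩
  · have hv : (((lam * ψ₂).toNNReal : ℝ≥0) : ℝ) = lam * ψ₂ :=
      Real.coe_toNNReal _ (mul_pos hlam hψ₂).le
    have hmap : gaussianReal ψ₁ (lam * ψ₂).toNNReal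
        = (gaussianReal 0 (lam * ψ₂).toNNReal).map (· + ψ₁) := by
      rw [gaussianReal_map_add_const, zero_add]
    rw [hmap, integral_map (by fun_prop) (by fun_prop)]
    have key := integral_sq_sub_mul_quadratic_gaussianReal (lam * ψ₂).toNNReal
      (r + (μ - r) * ψ₁ - γ * σ ^ 2 / 2 * ψ₁ ^ 2 - θ
        + lam / 2 * Real.log (2 * Real.pi * lam) + lam / 2 * Real.log ψ₂)
      ((μ - r) - γ * σ ^ 2 * ψ₁) (1 / (2 * ψ₂) - γ * σ ^ 2 / 2)
    rw [hv] at key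
    convert! key using 1
    · congr 1
      ext x
      ring
    · field_simp
  · have hγ : γ ≠ 0 := left_ne_zero_of_mul h
    have hσ : σ ≠ 0 := fun h0 ↦ h (by simp [h0])
    field_simp
end

section
/- For every u > 0 one has (1 + u)·e^{−u} < 1. Consequently, for all φ > 0, T > 0 and ε ≠ 0, the bias term (εT/(2φ))·e^{−2φT} − (ε/(4φ²))·(1 − e^{−2φT}) = (ε/(4φ²))·((1 + 2φT)·e^{−2φT} − 1) is nonzero (and is negative when ε > 0); hence the true policy gradient f′(φ) = −x·T·e^{−φT} + (εT/(2φ))·e^{−2φT} − (ε/(4φ²))·(1 − e^{−2φT}) differs from the naive policy-gradient estimate −x·T·e^{−φT} whenever ε ≠ 0. -/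
/-- The strict inequality `(1 + u) e^{-u} < 1` for `u > 0`. -/
theorem one_add_mul_exp_neg_lt_one {u : ℝ} (hu : 0 < u) : (1 + u) * Real.exp (-u) < 1 := by
  rw [Real.exp_neg, ← div_eq_mul_inv, div_lt_one (Real.exp_pos u), add_comm]
  exact Real.add_one_lt_exp hu.ne'

/-- Factored form of the policy-gradient bias term. -/
theorem policy_gradient_bias_eq {φ : ℝ} (hφ : φ ≠ 0) (T ε : ℝ) :
    (ε * T / (2 * φ)) * Real.exp (-2 * φ * T)
        - (ε / (4 * φ ^ 2)) * (1 - Real.exp (-2 * φ * T))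
      = (ε / (4 * φ ^ 2)) * ((1 + 2 * φ * T) * Real.exp (-2 * φ * T) - 1) := by
  generalize Real.exp (-2 * φ * T) = E
  field_simp
  ring

/-- `(1+u)e^{−u} < 1` for `u > 0`; consequently the policy-gradient bias term
is nonzero (negative when `ε > 0`), so the true gradient differs from the naive estimate. -/
theorem policy_gradient_bias_nonzero :
    (∀ u : ℝ, 0 < u → (1 + u) * Real.exp (-u) < 1) ∧
    ∀ φ T ε x : ℝ, 0 < φ → 0 < T → ε ≠ 0 →
      ((ε * T / (2 * φ)) * Real.exp (-2 * φ * T)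
          - (ε / (4 * φ ^ 2)) * (1 - Real.exp (-2 * φ * T))
        = (ε / (4 * φ ^ 2)) * ((1 + 2 * φ * T) * Real.exp (-2 * φ * T) - 1)) ∧
      ((ε * T / (2 * φ)) * Real.exp (-2 * φ * T)
          - (ε / (4 * φ ^ 2)) * (1 - Real.exp (-2 * φ * T)) ≠ 0) ∧
      (0 < ε → (ε * T / (2 * φ)) * Real.exp (-2 * φ * T)
          - (ε / (4 * φ ^ 2)) * (1 - Real.exp (-2 * φ * T)) < 0) ∧
      (-x * T * Real.exp (-φ * T) + (ε * T / (2 * φ)) * Real.exp (-2 * φ * T)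
          - (ε / (4 * φ ^ 2)) * (1 - Real.exp (-2 * φ * T))
        ≠ -x * T * Real.exp (-φ * T)) := by
  refine ⟨fun u hu => one_add_mul_exp_neg_lt_one hu, fun φ T ε x hφ hT hε => ?_⟩
  have hbias := policy_gradient_bias_eq hφ.ne' T ε
  have hneg : (1 + 2 * φ * T) * Real.exp (-2 * φ * T) - 1 < 0 := by
    have h := one_add_mul_exp_neg_lt_one (u := 2 * φ * T) (by positivity)
    rw [show -(2 * φ * T) = -2 * φ * T by ring] at h
    linarith
  have hne : (ε * T / (2 * φ)) * Real.exp (-2 * φ * T)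
      - (ε / (4 * φ ^ 2)) * (1 - Real.exp (-2 * φ * T)) ≠ 0 := by
    rw [hbias]
    exact mul_ne_zero (div_ne_zero hε (by positivity)) hneg.ne
  refine ⟨hbias, hne, fun hpos => ?_, fun h => hne (by linarith)⟩
  rw [hbias]
  exact mul_neg_of_pos_of_neg (by positivity) hneg
end

section
/- Let A, B, C, D, M, N, R, P, Q, k₁, k₂, β be real constants with N − k₂D² > 0, satisfying the three algebraic equations: k₂(2A + C²) − M + (k₂(B + CD) − R)²/(N − k₂D²) = 0; k₁A − P + (k₂(B + CD) − R)(k₁B − Q)/(N − k₂D²) = 0; and β = (k₁B − Q)²/(2(N − k₂D²)). Define f(x, a) = (Ax + Ba)(k₂x + k₁) + (1/2)(Cx + Da)²·k₂ − ((M/2)x² + Rxa + (N/2)a² + Px + Qa) − β. Then for every x ∈ ℝ, the function a ↦ f(x, a) attains its maximum over a ∈ ℝ at a*(x) = ((k₂(B + CD) − R)x + k₁B − Q)/(N − k₂D²), and the maximum value is f(x, a*(x)) = 0. -/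
/-- verification of the ergodic LQ HJB equation at the quadratic candidate
value function: the HJB integrand `f(x, a)` is maximized over `a ∈ ℝ` at
`a*(x) = ((k₂(B+CD) − R)x + k₁B − Q)/(N − k₂D²)` with maximum value `0`. -/
theorem lq_hjb_verification
    (A B C D M N R P Q k₁ k₂ β : ℝ)
    (hN : 0 < N - k₂ * D ^ 2)
    (h1 : k₂ * (2 * A + C ^ 2) - M + (k₂ * (B + C * D) - R) ^ 2 / (N - k₂ * D ^ 2) = 0)
    (h2 : k₁ * A - P + (k₂ * (B + C * D) - R) * (k₁ * B - Q) / (N - k₂ * D ^ 2) = 0)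
    (h3 : β = (k₁ * B - Q) ^ 2 / (2 * (N - k₂ * D ^ 2)))
    (f : ℝ → ℝ → ℝ)
    (hf : ∀ x a, f x a
      = (A * x + B * a) * (k₂ * x + k₁) + (1 / 2) * (C * x + D * a) ^ 2 * k₂
        - (M / 2 * x ^ 2 + R * x * a + N / 2 * a ^ 2 + P * x + Q * a) - β)
    (astar : ℝ → ℝ)
    (hastar : ∀ x, astar x = ((k₂ * (B + C * D) - R) * x + k₁ * B - Q) / (N - k₂ * D ^ 2)) :
    ∀ x : ℝ, (∀ a : ℝ, f x a ≤ f x (astar x)) ∧ f x (astar x) = 0 := by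
  have completed_square : ∀ x a, f x a = -((N - k₂ * D ^ 2) / 2 * (a - astar x) ^ 2) := by
    intro x a
    have hlin : (N - k₂ * D ^ 2) * astar x = (k₂ * (B + C * D) - R) * x + k₁ * B - Q := by
      rw [hastar, mul_div_cancel₀ _ hN.ne']
    have hquad : (N - k₂ * D ^ 2) / 2 * astar x ^ 2
        = (k₂ * (B + C * D) - R) ^ 2 / (N - k₂ * D ^ 2) * x ^ 2 / 2
          + (k₂ * (B + C * D) - R) * (k₁ * B - Q) / (N - k₂ * D ^ 2) * x
          + (k₁ * B - Q) ^ 2 / (2 * (N - k₂ * D ^ 2)) := by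
      rw [hastar]
      generalize N - k₂ * D ^ 2 = S at hN
      field_simp
      ring
    rw [hf]
    linear_combination x ^ 2 / 2 * h1 + x * h2 - h3 - a * hlin + hquad
  intro x
  have hmax : f x (astar x) = 0 := by simp [completed_square]
  refine ⟨fun a => ?_, hmax⟩
  rw [hmax, completed_square, neg_nonpos]
  positivity
end
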